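/- arXiv:1712.06198 — 7 statements merged into one kernel-verified Lean document; each statement's English description precedes it below -/
import Mathlib

section
/- Let L be a first-order language, let M be an L-structure, and let β(M) be the ultrafilter extension of M. Then the map pure : M → Ultrafilter M, sending each a ∈ M to the principal ultrafilter at a, is an isomorphic embedding (an L-embedding) of M into β(M). -/
open FirstOrder Language

/-- Iterated ultrafilter quantifier: `extProp D φ` says
`(∀^{D 0} x_0)(∀^{D 1} x_1) … (∀^{D (n-1)} x_(n-1)) φ(x)`. -/
def extProp {M : Type*} : ∀ {n : ℕ}, (Fin n → Ultrafilter M) → ((Fin n → M) → Prop) → Prop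
  | 0, _, φ => φ Fin.elim0
  | _ + 1, D, φ =>
      {a : M | extProp (fun i => D i.succ) (fun x => φ (Fin.cons a x))} ∈ D 0

/-- Ultrafilter extension of an `n`-ary function: the unique ultrafilter `D` such that
`A ∈ D` iff `(∀^{D 0} x_0) … (∀^{D (n-1)} x_(n-1)) f x ∈ A`. -/
def extFun {M : Type*} : ∀ {n : ℕ}, (Fin n → Ultrafilter M) → ((Fin n → M) → M) → Ultrafilter M
  | 0, _, f => pure (f Fin.elim0)
  | _ + 1, D, f =>
      (D 0).bind fun a => extFun (fun i => D i.succ) (fun x => f (Fin.cons a x))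

/-- The ultrafilter extension `β(M)` of an `L`-structure `M`. -/
noncomputable instance ultrafilterStructure (L : Language) (M : Type*) [L.Structure M] :
    L.Structure (Ultrafilter M) where
  funMap f D := extFun D fun x => Structure.funMap f x
  RelMap r D := extProp D fun x => Structure.RelMap r x

theorem extProp_pure {M : Type*} {n : ℕ} (x : Fin n → M) (φ : (Fin n → M) → Prop) :
    extProp (fun i => pure (x i)) φ ↔ φ x := by
  induction n with
  | zero => rw [extProp, Subsingleton.elim x Fin.elim0]
  | succ n ih =>
    rw [extProp, Ultrafilter.mem_pure, Set.mem_ofPred_eq, ih (fun i => x i.succ)]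
    exact iff_of_eq (congrArg φ (Fin.cons_self_tail x))

theorem extFun_pure {M : Type*} {n : ℕ} (x : Fin n → M) (f : (Fin n → M) → M) :
    extFun (fun i => pure (x i)) f = pure (f x) := by
  induction n with
  | zero => rw [extFun, Subsingleton.elim x Fin.elim0]
  | succ n ih =>
    have pure_bind (a : M) (g : M → Ultrafilter M) : (pure a : Ultrafilter M).bind g = g a :=
      Ultrafilter.coe_injective (Filter.pure_bind a fun b => (g b : Filter M))
    rw [extFun, pure_bind, ih (fun i => x i.succ)]
    exact congrArg (fun y => pure (f y)) (Fin.cons_self_tail x)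

/-- The map `pure : M → Ultrafilter M`, sending each `a` to the principal ultrafilter at `a`,
is an isomorphic embedding (an `L`-embedding) of `M` into its ultrafilter extension `β(M)`. -/
theorem pure_isEmbedding_into_ultrafilterExtension
    (L : Language) (M : Type*) [L.Structure M] :
    ∃ e : M ↪[L] Ultrafilter M, ∀ a : M, e a = pure a := by
  exact ⟨{ toFun := pure
           inj' := Ultrafilter.pure_injective
           map_fun' := fun f x => (extFun_pure x (Structure.funMap f)).symm
           map_rel' := fun r x => extProp_pure x (Structure.RelMap r) }, fun _ => rfl⟩
end

section
/- Let L be a first-order language, let M1 and M2 be L-structures, and let h : M1 → M2 be an L-homomorphism. Then the map Ultrafilter.map h : Ultrafilter M1 → Ultrafilter M2 (the continuous extension of h, sending D to its pushforward ultrafilter) is an L-homomorphism of the ultrafilter extension β(M1) into β(M2). (First Extension Theorem, homomorphism case.) -/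
open FirstOrder Language

theorem extProp_mono {M : Type*} : ∀ {n : ℕ} (D : Fin n → Ultrafilter M)
    {φ ψ : (Fin n → M) → Prop}, (∀ x, φ x → ψ x) → extProp D φ → extProp D ψ
  | 0, _, _, _, H => H _
  | _ + 1, _, _, _, H =>
      fun hφ => Filter.mem_of_superset hφ fun _ => extProp_mono _ fun _ => H _

theorem extProp_map {M N : Type*} (h : M → N) : ∀ {n : ℕ} (D : Fin n → Ultrafilter M)
    (φ : (Fin n → N) → Prop),
    extProp (fun i => (D i).map h) φ ↔ extProp D fun x => φ (h ∘ x)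
  | 0, _, φ => by
      simp only [extProp]
      rw [Subsingleton.elim (h ∘ Fin.elim0) Fin.elim0]
  | _ + 1, D, φ => by
      simp only [extProp, Ultrafilter.mem_map, Set.preimage_ofPred_eq, extProp_map h, Fin.comp_cons]

theorem mem_extFun {M : Type*} (A : Set M) : ∀ {n : ℕ} (D : Fin n → Ultrafilter M)
    (f : (Fin n → M) → M), A ∈ extFun D f ↔ extProp D fun x => f x ∈ A
  | 0, _, _ => Iff.rfl
  | _ + 1, D, f => by
      change {a | A ∈ extFun _ _} ∈ D 0 ↔ _
      simp only [mem_extFun A, extProp]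

/-- First Extension Theorem, homomorphism case: if `h : M1 → M2` is an `L`-homomorphism,
then `Ultrafilter.map h` is an `L`-homomorphism of `β(M1)` into `β(M2)`. -/
theorem ultrafilterMap_isHom (L : Language) (M1 M2 : Type*)
    [L.Structure M1] [L.Structure M2] (h : M1 →[L] M2) :
    ∃ g : Ultrafilter M1 →[L] Ultrafilter M2, ⇑g = Ultrafilter.map ⇑h := by
  refine ⟨⟨Ultrafilter.map h, fun f D => ?_, fun r D hr => ?_⟩, rfl⟩
  · refine Ultrafilter.ext fun A => ?_
    change h ⁻¹' A ∈ extFun D _ ↔ A ∈ extFun (fun i => (D i).map h) _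
    simp only [mem_extFun, extProp_map, Set.mem_preimage, h.map_fun]
  · exact (extProp_map h D _).2 (extProp_mono D (fun x => h.map_rel r x) hr)
end

section
/- Let F : ℕ → ℕ → ℕ be an unordered pairing function, i.e., for all a₁, b₁, a₂, b₂ ∈ ℕ, F a₁ b₁ = F a₂ b₂ iff {a₁, b₁} = {a₂, b₂} as sets. If D₁ and D₂ are distinct free (non-principal) ultrafilters on ℕ, then F̃(D₁, D₂) ≠ F̃(D₂, D₁), where F̃ is the ultrafilter extension of F. -/
/-- The ultrafilter extension of a binary operation `F : M → M → M`:
`A ∈ ext2 F D₁ D₂` iff `{a | {b | F a b ∈ A} ∈ D₂} ∈ D₁`. -/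
def ext2 {M : Type*} (F : M → M → M) (D₁ D₂ : Ultrafilter M) : Ultrafilter M :=
  D₁.bind fun a => Ultrafilter.map (F a) D₂

/-- The ultrafilter extension of a binary relation `R : M → M → Prop`:
`extRel R D₁ D₂` iff `{a | {b | R a b} ∈ D₂} ∈ D₁`. -/
def extRel {M : Type*} (R : M → M → Prop) (D₁ D₂ : Ultrafilter M) : Prop :=
  {a : M | {b : M | R a b} ∈ D₂} ∈ D₁

theorem mem_ext2 {M : Type*} (F : M → M → M) (D₁ D₂ : Ultrafilter M) (A : Set M) :
    A ∈ ext2 F D₁ D₂ ↔ {a | {b | F a b ∈ A} ∈ D₂} ∈ D₁ :=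
  Iff.rfl

theorem Ultrafilter.compl_mem_of_finite {α : Type*} {D : Ultrafilter α}
    (hD : ¬ ∃ a, D = pure a) {s : Set α} (hs : s.Finite) : sᶜ ∈ D := by
  obtain h | ⟨a, ha⟩ := D.le_cofinite_or_eq_pure
  · exact h hs.compl_mem_cofinite
  · exact absurd ⟨a, ha⟩ hD

/-- If `F` is an unordered pairing function on `ℕ` and `D₁ ≠ D₂` are free ultrafilters
on `ℕ`, then `F̃(D₁, D₂) ≠ F̃(D₂, D₁)`. -/
theorem ext2_ne_of_free_ne (F : ℕ → ℕ → ℕ)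
    (hF : ∀ a₁ b₁ a₂ b₂ : ℕ, F a₁ b₁ = F a₂ b₂ ↔ ({a₁, b₁} : Set ℕ) = {a₂, b₂})
    (D₁ D₂ : Ultrafilter ℕ)
    (h1 : ¬ ∃ a, D₁ = pure a) (h2 : ¬ ∃ a, D₂ = pure a) (hne : D₁ ≠ D₂) :
    ext2 F D₁ D₂ ≠ ext2 F D₂ D₁ := by
  intro heq
  obtain ⟨B, hB₁, hB₂⟩ : ∃ B ∈ D₁, B ∉ D₂ := by
    by_contra! h
    exact hne (Ultrafilter.coe_le_coe.1 h).symm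
  rw [← Ultrafilter.compl_mem_iff_notMem] at hB₂
  let A : Set ℕ := {n | ∃ a b, a < b ∧ a ∈ B ∧ b ∉ B ∧ F a b = n}
  have hA : A ∈ ext2 F D₁ D₂ := by
    rw [mem_ext2]
    filter_upwards [hB₁] with a ha
    filter_upwards [hB₂, Ultrafilter.compl_mem_of_finite h2 (Set.finite_Iic a)] with b hb hab
    exact ⟨a, b, by simpa using hab, ha, hb, rfl⟩
  rw [heq, mem_ext2] at hA
  obtain ⟨a, haA, haB⟩ := D₂.nonempty_of_mem (Filter.inter_mem hA hB₂)
  obtain ⟨b, ⟨c, d, hcd, hc, hd, h⟩, hab⟩ := D₁.nonempty_of_mem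
    (Filter.inter_mem haA (Ultrafilter.compl_mem_of_finite h1 (Set.finite_Iic a)))
  rw [hF, Set.pair_eq_pair_iff] at h
  have hab : a < b := by simpa using hab
  obtain ⟨rfl, rfl⟩ | ⟨rfl, rfl⟩ := h
  · exact haB hc
  · exact lt_asymm hab hcd
end

section
/- Let X be a linearly ordered set and let D be a free (non-principal) ultrafilter on X. Define I_D as the intersection of all initial segments (downward closed subsets) of X belonging to D, and J_D as the intersection of all final segments (upward closed subsets) of X belonging to D. Then I_D ∩ J_D = ∅, I_D ∪ J_D = X, and exactly one of I_D, J_D belongs to D. -/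
namespace Ultrafilter

variable {X : Type*} {D : Ultrafilter X} {x : X}

theorem singleton_notMem_of_free (hfree : ¬ ∃ a, D = pure a) (x : X) : {x} ∉ D := fun h =>
  hfree ⟨x, D.eq_of_le (by simpa [Ultrafilter.coe_pure, Filter.le_pure_iff] using h)⟩

variable [LinearOrder X]

theorem Ioi_mem_iff_Iio_notMem (hx : {x} ∉ D) : Set.Ioi x ∈ D ↔ Set.Iio x ∉ D := by
  rw [← Set.compl_Iic, compl_mem_iff_notMem, ← Set.Iio_union_right, union_mem_iff]
  tauto

theorem mem_sInter_isLowerSet_iff (hx : {x} ∉ D) :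
    x ∈ ⋂₀ {S : Set X | S ∈ D ∧ ∀ ⦃x y : X⦄, y ∈ S → x ≤ y → x ∈ S} ↔ Set.Ioi x ∈ D := by
  constructor
  · intro h
    rw [Ioi_mem_iff_Iio_notMem hx]
    exact fun hS => lt_irrefl x (h (Set.Iio x) ⟨hS, fun _ _ hb hab => hab.trans_lt hb⟩)
  · rintro h S ⟨hS, hlower⟩
    obtain ⟨y, hyS, hxy⟩ := D.nonempty_of_mem (Filter.inter_mem hS h)
    exact hlower hyS hxy.le

theorem mem_sInter_isUpperSet_iff (hx : {x} ∉ D) :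
    x ∈ ⋂₀ {S : Set X | S ∈ D ∧ ∀ ⦃x y : X⦄, x ∈ S → x ≤ y → y ∈ S} ↔ Set.Iio x ∈ D := by
  constructor
  · intro h
    by_contra hS
    rw [← Ioi_mem_iff_Iio_notMem hx] at hS
    exact lt_irrefl x (h (Set.Ioi x) ⟨hS, fun _ _ ha hab => lt_of_lt_of_le ha hab⟩)
  · rintro h S ⟨hS, hupper⟩
    obtain ⟨y, hyS, hyx⟩ := D.nonempty_of_mem (Filter.inter_mem hS h)
    exact hupper hyS hyx.le

end Ultrafilter

/-- For a free ultrafilter `D` on a linear order `X`, let `I_D` be the intersection of all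
initial segments (downward closed sets) in `D` and `J_D` the intersection of all final
segments (upward closed sets) in `D`. Then `(I_D, J_D)` is a cut: they are disjoint, cover
`X`, and exactly one of them belongs to `D`. -/
theorem cut_of_free_ultrafilter {X : Type*} [LinearOrder X]
    (D : Ultrafilter X) (hfree : ¬ ∃ a, D = pure a) :
    let I := ⋂₀ {S : Set X | S ∈ D ∧ ∀ ⦃x y : X⦄, y ∈ S → x ≤ y → x ∈ S}
    let J := ⋂₀ {S : Set X | S ∈ D ∧ ∀ ⦃x y : X⦄, x ∈ S → x ≤ y → y ∈ S}
    I ∩ J = ∅ ∧ I ∪ J = Set.univ ∧ Xor' (I ∈ D) (J ∈ D) := by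
  intro I J
  have hJ : J = Iᶜ := by
    ext x
    have hx := Ultrafilter.singleton_notMem_of_free hfree x
    rw [Set.mem_compl_iff, Ultrafilter.mem_sInter_isLowerSet_iff hx,
      Ultrafilter.mem_sInter_isUpperSet_iff hx, Ultrafilter.Ioi_mem_iff_Iio_notMem hx, not_not]
  rw [hJ, Ultrafilter.compl_mem_iff_notMem]
  exact ⟨Set.inter_compl_self I, Set.union_compl_self I, xor_not_right.mpr Iff.rfl⟩
end

section
/- Let X be a linearly ordered set, let D be a free (non-principal) ultrafilter on X, and let I_D be the intersection of all initial segments (downward closed subsets) of X belonging to D. If I_D ∈ D, then: (i) I_D has no greatest element; and (ii) for every S ∈ D, the set S ∩ I_D is cofinal in I_D, i.e., for every x ∈ I_D there is y ∈ S ∩ I_D with x < y. -/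
theorem Ultrafilter.eq_pure_of_singleton_mem {X : Type*} {D : Ultrafilter X} {a : X}
    (h : {a} ∈ D) : D = pure a :=
  Ultrafilter.coe_le_coe.1 (Filter.le_pure_iff.2 h)

/-- A point lying in every initial segment of a free ultrafilter has its strict upper ray
in the ultrafilter. -/
theorem Ultrafilter.Ioi_mem_of_mem_initialSegments {X : Type*} [LinearOrder X]
    {D : Ultrafilter X} (hfree : ¬ ∃ a, D = pure a) {x : X}
    (hx : x ∈ ⋂₀ {S : Set X | S ∈ D ∧ ∀ ⦃x y : X⦄, y ∈ S → x ≤ y → x ∈ S}) :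
    Set.Ioi x ∈ D := by
  have hIio : Set.Iio x ∉ D := fun h ↦
    lt_irrefl x (hx (Set.Iio x) ⟨h, fun _ _ hb hab ↦ hab.trans_lt hb⟩)
  have hne : ({x} : Set X) ∉ D := fun h ↦ hfree ⟨x, eq_pure_of_singleton_mem h⟩
  have hIci : (Set.Iio x)ᶜ ∈ D := Ultrafilter.compl_mem_iff_notMem.2 hIio
  have hcompl : ({x} : Set X)ᶜ ∈ D := Ultrafilter.compl_mem_iff_notMem.2 hne
  filter_upwards [hIci, hcompl] with y hy hyx
  exact lt_of_le_of_ne (not_lt.1 hy) (Ne.symm hyx)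

/-- For a free ultrafilter `D` on a linear order `X`, if the intersection `I_D` of all
initial segments (downward closed sets) belonging to `D` itself belongs to `D`, then
`I_D` has no greatest element, and for every `S ∈ D` the set `S ∩ I_D` is cofinal
in `I_D`. -/
theorem initialSegment_no_max_and_cofinal {X : Type*} [LinearOrder X]
    (D : Ultrafilter X) (hfree : ¬ ∃ a, D = pure a) :
    let I := ⋂₀ {S : Set X | S ∈ D ∧ ∀ ⦃x y : X⦄, y ∈ S → x ≤ y → x ∈ S}
    I ∈ D →
      (∀ x ∈ I, ∃ y ∈ I, x < y) ∧
      (∀ S ∈ D, ∀ x ∈ I, ∃ y ∈ S ∩ I, x < y) := by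
  intro I hI
  have cofinal : ∀ S ∈ D, ∀ x ∈ I, ∃ y ∈ S ∩ I, x < y := fun S hS x hx ↦
    D.nonempty_of_mem (Filter.inter_mem (Filter.inter_mem hS hI)
      (Ultrafilter.Ioi_mem_of_mem_initialSegments hfree hx))
  exact ⟨fun x hx ↦ (cofinal I hI x hx).imp fun y hy ↦ ⟨hy.1.1, hy.2⟩, cofinal⟩
end

section
/- Let X and Y be sets with X infinite and |Y| ≤ |X|, and let R : X → Y → Prop be any relation. Then there exist two distinct ultrafilters D₁ ≠ D₂ on X such that for every b ∈ Y, {a ∈ X | R a b} ∈ D₁ iff {a ∈ X | R a b} ∈ D₂. (Equivalently: the map G : Ultrafilter X → Set Y defined by G(D) = {b ∈ Y | {a | R a b} ∈ D} is not injective.) -/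
universe u v

open Filter in
/-- Finitely many sets are distinguished by their traces on some finite set. -/
theorem exists_finset_injOn_filter_mem {X : Type u} [∀ A : Set X, DecidablePred (· ∈ A)]
    (T : Finset (Set X)) :
    ∃ F : Finset X, Set.InjOn (fun A : Set X => F.filter (· ∈ A)) T := by
  have h : ∀ᶠ F : Finset X in atTop, ∀ A ∈ T, ∀ B ∈ T,
      F.filter (· ∈ A) = F.filter (· ∈ B) → A = B := by
    simp only [eventually_all_finset]
    intro A _ B _
    by_cases hAB : A = B
    · exact Eventually.of_forall fun _ _ => hAB
    · obtain ⟨x, hx⟩ : ∃ x, ¬(x ∈ A ↔ x ∈ B) := by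
        simpa [Set.ext_iff] using hAB
      filter_upwards [eventually_ge_atTop {x}] with F hF hEq
      have hxF : x ∈ F := hF (Finset.mem_singleton_self x)
      have := Finset.ext_iff.1 hEq x
      simp only [Finset.mem_filter, hxF, true_and] at this
      exact absurd this hx
  obtain ⟨F, hF⟩ := h.exists
  exact ⟨F, fun A hA B hB => hF A hA B hB⟩

open Cardinal in
/-- **Fichtenholz–Kantorovich–Hausdorff**: an infinite set `X` carries an independent family of
subsets indexed by the power set of `X`. -/
theorem exists_independent_family (X : Type u) [Infinite X] :
    ∃ B : Set X → Set X, ∀ (𝒜 : Set (Set X)) (T : Finset (Set X)),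
      ∃ x, ∀ A ∈ T, x ∈ B A ↔ A ∈ 𝒜 := by
  classical
  obtain ⟨e⟩ : Nonempty (X ≃ Finset X × Finset (Finset X)) := by
    rw [← Cardinal.eq]
    simp [mul_eq_self (aleph0_le_mk X)]
  refine ⟨fun A => {x | (e x).1.filter (· ∈ A) ∈ (e x).2}, fun 𝒜 T => ?_⟩
  obtain ⟨F, hF⟩ := exists_finset_injOn_filter_mem T
  refine ⟨e.symm (F, (T.filter (· ∈ 𝒜)).image fun A => F.filter (· ∈ A)), fun A hA => ?_⟩
  simp only [Set.mem_ofPred_eq, Equiv.apply_symm_apply, Finset.mem_image, Finset.mem_filter]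
  constructor
  · rintro ⟨A', ⟨hA', h𝒜⟩, hEq⟩
    exact hF hA' hA hEq ▸ h𝒜
  · exact fun h => ⟨A, ⟨hA, h⟩, rfl⟩

open Filter in
/-- **Pospíšil**: an infinite set `X` carries at least as many ultrafilters as there are families
of subsets of `X`. -/
theorem exists_injective_setSet_ultrafilter (X : Type u) [Infinite X] :
    ∃ f : Set (Set X) → Ultrafilter X, Function.Injective f := by
  obtain ⟨B, hB⟩ := exists_independent_family X
  choose p hp using hB
  have key (𝒜 : Set (Set X)) (A : Set X) :
      B A ∈ Ultrafilter.of (map (p 𝒜) atTop) ↔ A ∈ 𝒜 := by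
    have h : ∀ᶠ x in Ultrafilter.of (map (p 𝒜) atTop), x ∈ B A ↔ A ∈ 𝒜 := by
      refine Ultrafilter.of_le _ (mem_map.2 ?_)
      filter_upwards [eventually_ge_atTop {A}] with T hT
      exact hp 𝒜 T A (hT (Finset.mem_singleton_self A))
    exact (eventually_congr h).trans eventually_const
  refine ⟨fun 𝒜 => Ultrafilter.of (map (p 𝒜) atTop), fun 𝒜 𝒜' h => Set.ext fun A => ?_⟩
  rw [← key 𝒜 A, ← key 𝒜' A]
  exact iff_of_eq (congrArg (B A ∈ ·) h)

/-- If `X` is infinite, `|Y| ≤ |X|`, and `R : X → Y → Prop` is any relation, then there are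
two distinct ultrafilters on `X` that agree on all the sets `{a | R a b}`, `b ∈ Y`. -/
theorem exists_two_ultrafilters_agreeing_on_relation {X : Type u} {Y : Type v}
    [Infinite X] (hY : Cardinal.lift.{u} (Cardinal.mk Y) ≤ Cardinal.lift.{v} (Cardinal.mk X))
    (R : X → Y → Prop) :
    ∃ D₁ D₂ : Ultrafilter X, D₁ ≠ D₂ ∧
      ∀ b : Y, ({a : X | R a b} ∈ D₁ ↔ {a : X | R a b} ∈ D₂) := by
  obtain ⟨i⟩ := Cardinal.lift_mk_le'.1 hY
  obtain ⟨f, hf⟩ := exists_injective_setSet_ultrafilter X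
  by_contra! h
  have hG : Function.Injective fun D : Ultrafilter X => {b : Y | {a : X | R a b} ∈ D} := by
    intro D₁ D₂ hD
    by_contra hne
    obtain ⟨b, hb⟩ := h D₁ D₂ hne
    have := Set.ext_iff.1 hD b
    simp only [Set.mem_ofPred_eq] at this
    tauto
  exact Function.cantor_injective _ ((Set.image_injective.2 i.injective).comp (hG.comp hf))
end

section
/- For every infinite set X, the cardinality of the set of ultrafilters on X equals 2^(2^|X|): #(Ultrafilter X) = 2 ^ (2 ^ #X). -/
universe u

/-- Finitely many subsets of `X` are distinguished by their traces on some finite set. -/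
theorem Finset.exists_finset_injOn_filter_mem {X : Type u} [Nonempty X] (s : Finset (Set X)) :
    ∃ F : Finset X, ∀ A ∈ s, ∀ B ∈ s, (∀ x ∈ F, x ∈ A ↔ x ∈ B) → A = B := by
  classical
  have h : ∀ A B : Set X, ∃ x, (x ∈ A ↔ x ∈ B) → A = B := by
    intro A B
    by_contra! h
    exact (h (Classical.arbitrary X)).2 (Set.ext fun x => (h x).1)
  choose x hx using h
  refine ⟨(s ×ˢ s).image fun p => x p.1 p.2, fun A hA B hB hAB => hx A B (hAB _ ?_)⟩
  exact Finset.mem_image.2 ⟨(A, B), Finset.mk_mem_product hA hB, rfl⟩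

open Classical in
/-- The independent family of Fichtenholz, Kantorovich and Hausdorff, indexed by the subsets
of `X`. -/
def independentFamily {X : Type u} (A : Set X) : Set (Finset X × Finset (Finset X)) :=
  {p | p.1.filter (· ∈ A) ∈ p.2}

/-- Membership in finitely many members of `independentFamily` can be prescribed arbitrarily. -/
theorem exists_forall_mem_independentFamily_iff {X : Type u} [Nonempty X] (s : Finset (Set X))
    (𝒜 : Set (Set X)) : ∃ p, ∀ A ∈ s, p ∈ independentFamily A ↔ A ∈ 𝒜 := by
  classical
  obtain ⟨F, hF⟩ := s.exists_finset_injOn_filter_mem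
  refine ⟨(F, (s.filter (· ∈ 𝒜)).image fun A => F.filter (· ∈ A)), fun A hA => ?_⟩
  simp only [independentFamily, Set.mem_ofPred_eq, Finset.mem_image, Finset.mem_filter]
  constructor
  · rintro ⟨B, ⟨hB, hB𝒜⟩, hBA⟩
    rwa [← hF B hB A hA (Finset.filter_inj'.1 (by convert hBA))]
  · exact fun h => ⟨A, ⟨hA, h⟩, by congr⟩

/-- Membership of the sets of `independentFamily` in an ultrafilter can be prescribed
arbitrarily. -/
theorem exists_ultrafilter_independentFamily_mem_iff {X : Type u} [Nonempty X]
    (𝒜 : Set (Set X)) :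
    ∃ f : Ultrafilter (Finset X × Finset (Finset X)), ∀ A, independentFamily A ∈ f ↔ A ∈ 𝒜 := by
  classical
  obtain ⟨f, hf⟩ := Ultrafilter.exists_ultrafilter_of_finite_inter_nonempty
    (Set.range fun A : Set X => {p | p ∈ independentFamily A ↔ A ∈ 𝒜}) (by
      intro T hT
      obtain ⟨s, -, rfl⟩ := Finset.subset_set_image_iff.1 (Set.image_univ.symm ▸ hT)
      obtain ⟨p, hp⟩ := exists_forall_mem_independentFamily_iff s 𝒜
      exact ⟨p, by simpa using hp⟩)
  refine ⟨f, fun A => ?_⟩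
  have hA : ∀ᶠ p in (f : Filter _), p ∈ independentFamily A ↔ A ∈ 𝒜 := hf ⟨A, rfl⟩
  exact (Filter.eventually_congr hA).trans Filter.eventually_const

/-- For every infinite set `X`, there are exactly `2 ^ 2 ^ |X|` ultrafilters on `X`. -/
theorem mk_ultrafilter (X : Type u) [Infinite X] :
    Cardinal.mk (Ultrafilter X) = (2 : Cardinal) ^ ((2 : Cardinal) ^ Cardinal.mk X) := by
  rw [← Cardinal.mk_set, ← Cardinal.mk_set]
  apply le_antisymm
  · exact Cardinal.mk_le_of_injective (f := fun f : Ultrafilter X => {s | s ∈ f})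
      fun f g h => Ultrafilter.ext fun s => Set.ext_iff.1 h s
  · obtain ⟨e⟩ : Nonempty (Finset X × Finset (Finset X) ≃ X) := Cardinal.eq.1 (by simp)
    choose f hf using exists_ultrafilter_independentFamily_mem_iff (X := X)
    have hinj : Function.Injective f := fun 𝒜 ℬ h => Set.ext fun A => by rw [← hf, h, hf]
    refine Cardinal.mk_le_of_injective (f := fun 𝒜 => (f 𝒜).map e) fun 𝒜 ℬ h => hinj ?_
    refine Ultrafilter.coe_injective (Filter.map_injective e.injective ?_)
    exact congrArg Ultrafilter.toFilter h
end
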